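/- Let X be a CAT(0) space in which some bi-infinite geodesic is a contracting geodesic, and suppose the limit set Λ ⊂ ∂X of a group action is visible from the contracting endpoint (every ξ ∈ Λ is joined to a(∞) by a bi-infinite geodesic in X). Then for every ξ ∈ Λ the Tits distance satisfies d_T(a(∞), ξ) > π. -/

import Mathlib

open Metric Set Filter

variable {X : Type*} [MetricSpace X]

/-- A metric space is CAT(0) if midpoints exist and satisfy the CN comparison inequality. -/
def IsCAT0 (X : Type*) [MetricSpace X] : Prop :=
  ∀ x y : X, ∃ m : X, dist x m = dist x y / 2 ∧ dist y m = dist x y / 2 ∧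
    ∀ z : X, dist z m ^ 2 ≤ (dist z x ^ 2 + dist z y ^ 2) / 2 - dist x y ^ 2 / 4

/-- A geodesic ray: isometric embedding of `[0, ∞)`. -/
def IsRay (c : ℝ → X) : Prop :=
  ∀ s t : ℝ, 0 ≤ s → 0 ≤ t → dist (c s) (c t) = |s - t|

/-- A bi-infinite geodesic: isometric embedding of `ℝ`. -/
def IsGeodesicLine (c : ℝ → X) : Prop :=
  ∀ s t : ℝ, dist (c s) (c t) = |s - t|

/-- A geodesic segment from `y` to `z`, parametrized on `[0, dist y z]`. -/
def IsGeodesicSeg (g : ℝ → X) (y z : X) : Prop :=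
  g 0 = y ∧ g (dist y z) = z ∧
    ∀ s t, s ∈ Icc 0 (dist y z) → t ∈ Icc 0 (dist y z) → dist (g s) (g t) = |s - t|

/-- `π` is a nearest-point projection onto the set `S`. -/
def IsProjOn (S : Set X) (π : X → X) : Prop :=
  ∀ p : X, π p ∈ S ∧ ∀ q ∈ S, dist p (π p) ≤ dist p q

/-- The set `S` (image of a geodesic) is `A`-contracting. -/
def ContractingSet (A : ℝ) (S : Set X) : Prop :=
  ∃ π : X → X, IsProjOn S π ∧
    ∀ p q : X, dist p q < dist p (π p) → dist (π p) (π q) < A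

/-- Slimness with respect to a given nearest-point projection `π` onto `S`:
every geodesic from `y` to a point `z ∈ S` passes within `δ` of `π y`. -/
def SlimWith (δ : ℝ) (S : Set X) (π : X → X) : Prop :=
  ∀ y z, z ∈ S → ∀ g : ℝ → X, IsGeodesicSeg g y z →
    ∃ s ∈ Icc (0:ℝ) (dist y z), dist (π y) (g s) ≤ δ

/-- The set `S` is `δ`-slim. -/
def SlimSet (δ : ℝ) (S : Set X) : Prop :=
  ∃ π : X → X, IsProjOn S π ∧ SlimWith δ S π

/-- Two rays are asymptotic (bounded Hausdorff distance). -/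
def Asymp (a b : ℝ → X) : Prop :=
  ∃ M : ℝ, ∀ t : ℝ, 0 ≤ t → dist (a t) (b t) ≤ M

open scoped ENNReal

/-- Euclidean comparison angle at `p` between `a` and `b`. -/
noncomputable def compAngle (p a b : X) : ℝ :=
  Real.arccos ((dist p a ^ 2 + dist p b ^ 2 - dist a b ^ 2) / (2 * dist p a * dist p b))

/-- The Alexandrov angle between two rays issuing from the same point, as the infimum
of comparison angles (these are monotone in a CAT(0) space). -/
noncomputable def rayAngle (c c' : ℝ → X) : ℝ :=
  sInf {θ : ℝ | ∃ s t : ℝ, 0 < s ∧ 0 < t ∧ θ = compAngle (c 0) (c s) (c' t)}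

/-- The angle metric between boundary points (represented by rays `α`, `β`):
the supremum over basepoints of the Alexandrov angle between the representatives there. -/
noncomputable def bdryAngle (α β : ℝ → X) : ℝ :=
  sSup {θ : ℝ | ∃ c c' : ℝ → X, IsRay c ∧ IsRay c' ∧ c 0 = c' 0 ∧
    Asymp c α ∧ Asymp c' β ∧ θ = rayAngle c c'}

/-- Continuity of a path of boundary points with respect to the angle metric. -/
def AngleCont (γ : ℝ → ℝ → X) : Prop :=
  ∀ t ∈ Icc (0:ℝ) 1, ∀ ε > (0:ℝ), ∃ δ > (0:ℝ), ∀ s ∈ Icc (0:ℝ) 1,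
    |s - t| < δ → bdryAngle (γ s) (γ t) < ε

/-- Length of a path in the boundary with respect to the angle metric. -/
noncomputable def pathLen (γ : ℝ → ℝ → X) : ℝ≥0∞ :=
  ⨆ (n : ℕ) (u : ℕ → ℝ) (_ : Monotone u ∧ u 0 = 0 ∧ u n = 1 ∧ ∀ i, u i ∈ Icc (0:ℝ) 1),
    ENNReal.ofReal (∑ i ∈ Finset.range n, bdryAngle (γ (u i)) (γ (u (i + 1))))

/-- The Tits distance between two boundary points: the infimum of angle-lengths of
angle-continuous paths of rays joining them (`∞` if there is no such path). -/
noncomputable def titsDist (α β : ℝ → X) : ℝ≥0∞ :=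
  sInf {L : ℝ≥0∞ | ∃ γ : ℝ → ℝ → X, (∀ t ∈ Icc (0:ℝ) 1, IsRay (γ t)) ∧
    AngleCont γ ∧ Asymp (γ 0) α ∧ Asymp (γ 1) β ∧ L = pathLen γ}

/-- The point `m` divides the geodesic from `x` to `y` in the ratio `l : 1 - l`, in the form of
the CAT(0) comparison inequality for a triangle with a cevian. -/
def IsDivPt (x y m : X) (l : ℝ) : Prop :=
  ∀ z : X, dist z m ^ 2 ≤
    (1 - l) * dist z x ^ 2 + l * dist z y ^ 2 - l * (1 - l) * dist x y ^ 2

namespace IsDivPt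

variable {x y m m' : X} {l k : ℝ}

lemma symm (h : IsDivPt x y m l) : IsDivPt y x m (1 - l) := fun z => by
  have := h z
  rw [dist_comm y x]
  linarith

lemma dist_left_le (h : IsDivPt x y m l) (h0 : 0 ≤ l) : dist x m ≤ l * dist x y := by
  have := h x
  rw [dist_self] at this
  exact abs_le_of_sq_le_sq' (by linarith) (by positivity) |>.2

lemma dist_right_le (h : IsDivPt x y m l) (h1 : l ≤ 1) : dist y m ≤ (1 - l) * dist x y := by
  have := h.symm.dist_left_le (by linarith)
  rwa [dist_comm y x] at this

lemma dist_left (h : IsDivPt x y m l) (h0 : 0 ≤ l) (h1 : l ≤ 1) : dist x m = l * dist x y := by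
  have h2 := h.dist_left_le h0
  have h3 := h.dist_right_le h1
  have h4 := dist_triangle_right x y m
  linarith

lemma dist_right (h : IsDivPt x y m l) (h0 : 0 ≤ l) (h1 : l ≤ 1) :
    dist y m = (1 - l) * dist x y := by
  have h2 := h.dist_left_le h0
  have h3 := h.dist_right_le h1
  have h4 := dist_triangle_right x y m
  linarith

/-- Division points of a common segment are at the expected distance. -/
lemma dist_eq (h : IsDivPt x y m l) (h' : IsDivPt x y m' k)
    (h0 : 0 ≤ l) (h1 : l ≤ 1) (k0 : 0 ≤ k) (k1 : k ≤ 1) :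
    dist m m' = |l - k| * dist x y := by
  have e1 := h.dist_left h0 h1
  have e2 := h'.dist_left k0 k1
  have e3 := h'.dist_right k0 k1
  apply le_antisymm
  · have := h m'
    rw [dist_comm m' x, dist_comm m' y, e2, e3, dist_comm m' m] at this
    refine abs_le_of_sq_le_sq' ?_ (by positivity) |>.2
    rw [mul_pow, sq_abs]
    linarith
  · rw [← abs_of_nonneg (dist_nonneg (x := x) (y := y)), ← abs_mul, sub_mul, ← e1, ← e2,
      dist_comm x m, dist_comm x m']
    exact abs_dist_sub_le m m' x

/-- Comparison for two sides of a triangle issuing from a common vertex. -/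
lemma dist_le {p q y : X} (h : IsDivPt p q m l) (h' : IsDivPt y q m' l)
    (h0 : 0 ≤ l) (h1 : l ≤ 1) : dist m m' ≤ (1 - l) * dist p y := by
  have e := h.dist_right h0 h1
  have a1 := h' m
  have a2 := h y
  rw [dist_comm m q, e] at a1
  rw [dist_comm y m, dist_comm y p] at a2
  refine abs_le_of_sq_le_sq' ?_ (mul_nonneg (by linarith) dist_nonneg) |>.2
  have a3 := mul_le_mul_of_nonneg_left a2 (by linarith : 0 ≤ 1 - l)
  nlinarith

/-- The midpoint of two division points is a division point. -/
lemma midpoint {n : X} (h : IsDivPt x y m l) (h' : IsDivPt x y m' k)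
    (h0 : 0 ≤ l) (h1 : l ≤ 1) (k0 : 0 ≤ k) (k1 : k ≤ 1)
    (hn : ∀ z : X, dist z n ^ 2 ≤ (dist z m ^ 2 + dist z m' ^ 2) / 2 - dist m m' ^ 2 / 4) :
    IsDivPt x y n ((l + k) / 2) := fun z => by
  have a := hn z
  rw [h.dist_eq h' h0 h1 k0 k1, mul_pow, sq_abs] at a
  have a1 := h z
  have a2 := h' z
  nlinarith

end IsDivPt

lemma isDivPt_zero (x y : X) : IsDivPt x y x 0 := fun z => by simp

lemma isDivPt_one (x y : X) : IsDivPt x y y 1 := fun z => by simp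

lemma isClosed_setOf_isDivPt [ProperSpace X] (x y : X) :
    IsClosed {l : ℝ | l ∈ Icc (0 : ℝ) 1 ∧ ∃ m, IsDivPt x y m l} := by
  have hK : IsCompact {q : ℝ × X | q ∈ Icc (0 : ℝ) 1 ×ˢ closedBall x (dist x y) ∧
      IsDivPt x y q.2 q.1} := by
    refine (isCompact_Icc.prod (isCompact_closedBall x (dist x y))).inter_right ?_
    have : {q : ℝ × X | IsDivPt x y q.2 q.1} = ⋂ z : X, {q : ℝ × X | dist z q.2 ^ 2 ≤
        (1 - q.1) * dist z x ^ 2 + q.1 * dist z y ^ 2 - q.1 * (1 - q.1) * dist x y ^ 2} := by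
      ext q
      simp [IsDivPt]
    change IsClosed {q : ℝ × X | IsDivPt x y q.2 q.1}
    rw [this]
    exact isClosed_iInter fun z => isClosed_le (by fun_prop) (by fun_prop)
  convert (hK.image continuous_fst).isClosed using 1
  ext l
  constructor
  · rintro ⟨hl, m, hm⟩
    refine ⟨(l, m), ⟨⟨hl, ?_⟩, hm⟩, rfl⟩
    rw [mem_closedBall, dist_comm]
    exact (hm.dist_left_le hl.1).trans (mul_le_of_le_one_left dist_nonneg hl.2)
  · rintro ⟨⟨l, m⟩, ⟨⟨hl, -⟩, hm⟩, rfl⟩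
    exact ⟨hl, m, hm⟩

lemma IsCAT0.exists_isDivPt [ProperSpace X] (hX : IsCAT0 X) (x y : X) {l : ℝ}
    (h0 : 0 ≤ l) (h1 : l ≤ 1) : ∃ m, IsDivPt x y m l := by
  set S := {l : ℝ | l ∈ Icc (0 : ℝ) 1 ∧ ∃ m, IsDivPt x y m l} with hS
  have hc : IsClosed S := isClosed_setOf_isDivPt x y
  have hu : BddAbove (S ∩ Iic l) := ⟨l, fun _ h => h.2⟩
  have hd : BddBelow (S ∩ Ici l) := ⟨l, fun _ h => h.2⟩
  have hu' := (hc.inter isClosed_Iic).csSup_mem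
    (⟨0, ⟨⟨le_rfl, zero_le_one⟩, x, isDivPt_zero x y⟩, h0⟩ : (S ∩ Iic l).Nonempty) hu
  have hd' := (hc.inter isClosed_Ici).csInf_mem
    (⟨1, ⟨⟨zero_le_one, le_rfl⟩, y, isDivPt_one x y⟩, h1⟩ : (S ∩ Ici l).Nonempty) hd
  set u := sSup (S ∩ Iic l)
  set d := sInf (S ∩ Ici l)
  obtain ⟨⟨⟨u0, u1⟩, m, hm⟩, hul⟩ := hu'
  obtain ⟨⟨⟨d0, d1⟩, m', hm'⟩, hdl⟩ := hd'
  rw [mem_Iic] at hul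
  rw [mem_Ici] at hdl
  obtain ⟨n, -, -, hn⟩ := hX m m'
  have hmid : (u + d) / 2 ∈ S :=
    ⟨⟨by linarith, by linarith⟩, n, hm.midpoint hm' u0 u1 d0 d1 hn⟩
  have hud : u = d := by
    rcases le_total ((u + d) / 2) l with h | h
    · have : (u + d) / 2 ≤ u := le_csSup hu ⟨hmid, h⟩
      linarith
    · have : d ≤ (u + d) / 2 := csInf_le hd ⟨hmid, h⟩
      linarith
  have : l = u := by linarith
  exact ⟨m, this ▸ hm⟩

/-- In a CAT(0) space, a point at the right distances from `x` and `y` is a division point. -/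
lemma IsCAT0.isDivPt_of_dist_le [ProperSpace X] (hX : IsCAT0 X) {x y w : X} {l : ℝ}
    (h0 : 0 ≤ l) (h1 : l ≤ 1) (hx : dist x w ≤ l * dist x y)
    (hy : dist y w ≤ (1 - l) * dist x y) : IsDivPt x y w l := by
  obtain ⟨m, hm⟩ := hX.exists_isDivPt x y h0 h1
  have a := hm w
  have b1 : dist w x ^ 2 ≤ (l * dist x y) ^ 2 := by
    rw [dist_comm w x]
    gcongr
  have b2 : dist w y ^ 2 ≤ ((1 - l) * dist x y) ^ 2 := by
    rw [dist_comm w y]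
    gcongr
  have c1 := mul_le_mul_of_nonneg_left b1 (by linarith : 0 ≤ 1 - l)
  have c2 := mul_le_mul_of_nonneg_left b2 h0
  have hz : dist w m ^ 2 ≤ 0 := by nlinarith
  have : w = m := dist_eq_zero.1 (pow_eq_zero_iff two_ne_zero |>.1 (le_antisymm hz (sq_nonneg _)))
  exact this ▸ hm

lemma IsRay.isDivPt [ProperSpace X] (hX : IsCAT0 X) {c : ℝ → X} (hc : IsRay c) {l t : ℝ}
    (h0 : 0 ≤ l) (h1 : l ≤ 1) (ht : 0 ≤ t) : IsDivPt (c 0) (c t) (c (l * t)) l := by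
  have hlt : 0 ≤ l * t := mul_nonneg h0 ht
  have e : dist (c 0) (c t) = t := by rw [hc 0 t le_rfl ht, zero_sub, abs_neg, abs_of_nonneg ht]
  refine hX.isDivPt_of_dist_le h0 h1 ?_ ?_
  · rw [hc 0 _ le_rfl hlt, e, zero_sub, abs_neg, abs_of_nonneg hlt]
  · rw [hc t _ ht hlt, e, abs_of_nonneg (by nlinarith)]
    linarith

lemma IsRay.dist_zero {c : ℝ → X} (hc : IsRay c) {t : ℝ} (ht : 0 ≤ t) : dist (c 0) (c t) = t := by
  rw [hc 0 t le_rfl ht, zero_sub, abs_neg, abs_of_nonneg ht]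

lemma Asymp.symm {c c' : ℝ → X} (h : Asymp c c') : Asymp c' c := by
  obtain ⟨M, hM⟩ := h
  exact ⟨M, fun t ht => by rw [dist_comm]; exact hM t ht⟩

lemma Asymp.trans {c c' c'' : ℝ → X} (h : Asymp c c') (h' : Asymp c' c'') : Asymp c c'' := by
  obtain ⟨M, hM⟩ := h
  obtain ⟨N, hN⟩ := h'
  exact ⟨M + N, fun t ht => (dist_triangle _ (c' t) _).trans (add_le_add (hM t ht) (hN t ht))⟩

lemma IsGeodesicLine.isRay_shift {a : ℝ → X} (ha : IsGeodesicLine a) (r : ℝ) :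
    IsRay (fun t => a (r + t)) := fun s t _ _ => by
  rw [ha]
  congr 1
  ring

lemma IsGeodesicLine.isRay {a : ℝ → X} (ha : IsGeodesicLine a) : IsRay a :=
  fun s t _ _ => ha s t

lemma IsGeodesicLine.reverse {a : ℝ → X} (ha : IsGeodesicLine a) :
    IsGeodesicLine (fun t => a (-t)) := fun s t => by
  rw [ha, abs_sub_comm]
  congr 1
  ring

/-- The two ends of a geodesic line are not asymptotic. -/
lemma IsGeodesicLine.not_asymp_reverse {a : ℝ → X} (ha : IsGeodesicLine a) :
    ¬ Asymp a (fun t => a (-t)) := by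
  rintro ⟨M, hM⟩
  have h := hM (|M| + 1) (by positivity)
  rw [ha, abs_of_nonneg (by linarith [abs_nonneg M])] at h
  linarith [abs_nonneg M, le_abs_self M]

/-- A ray that returns infinitely often to a bounded neighbourhood of another ray is asymptotic
to it. -/
lemma IsCAT0.asymp_of_frequently [ProperSpace X] (hX : IsCAT0 X) {b a : ℝ → X} (hb : IsRay b)
    (ha : IsRay a) {C : ℝ} (h : ∃ᶠ t in atTop, ∃ s, 0 ≤ s ∧ dist (b t) (a s) ≤ C) :
    Asymp b a := by
  refine ⟨C + dist (b 0) (a 0) + (C + dist (b 0) (a 0)), fun t ht => ?_⟩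
  obtain ⟨T, hT, s, hs, hC⟩ := frequently_atTop.1 h (t + 1)
  have hT0 : 0 < T := by linarith
  have l0 : 0 ≤ t / T := by positivity
  have l1 : t / T ≤ 1 := by rw [div_le_one hT0]; linarith
  have hlT : t / T * T = t := div_mul_cancel₀ t hT0.ne'
  obtain ⟨m, hm⟩ := hX.exists_isDivPt (b 0) (a s) l0 l1
  have e1 := (hb.isDivPt hX l0 l1 hT0.le).symm.dist_le hm.symm (by linarith) (by linarith)
  have e2 := hm.dist_le (ha.isDivPt hX l0 l1 hs) l0 l1
  rw [hlT] at e1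
  have e3 : dist (a (t / T * s)) (a t) ≤ C + dist (b 0) (a 0) := by
    rw [ha _ _ (by positivity) ht]
    have : |s - T| ≤ C + dist (b 0) (a 0) := by
      have i1 := hb.dist_zero hT0.le
      have i2 := ha.dist_zero hs
      have i3 := dist_triangle4 (b 0) (a 0) (a s) (b T)
      have i4 := dist_triangle4 (a 0) (b 0) (b T) (a s)
      rw [dist_comm (a s) (b T)] at i3
      rw [dist_comm (a 0) (b 0)] at i4
      rw [abs_le]
      constructor <;> linarith
    calc |t / T * s - t| = |t / T * (s - T)| := by rw [mul_sub, hlT]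
      _ = t / T * |s - T| := by rw [abs_mul, abs_of_nonneg l0]
      _ ≤ |s - T| := mul_le_of_le_one_left (abs_nonneg _) l1
      _ ≤ _ := this
  have e1' : dist (b t) m ≤ C := by
    refine (e1.trans ?_).trans hC
    rw [sub_sub_cancel]
    exact mul_le_of_le_one_left dist_nonneg l1
  have e2' : dist m (a (t / T * s)) ≤ dist (b 0) (a 0) :=
    e2.trans (mul_le_of_le_one_left dist_nonneg (by linarith))
  have := dist_triangle4 (b t) m (a (t / T * s)) (a t)
  linarith

/-- A ray outside a large neighbourhood of a contracting set has bounded projection. -/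
lemma IsRay.dist_proj_le {π : X → X} {A : ℝ} (hA : 0 < A)
    (hcon : ∀ p q : X, dist p q < dist p (π p) → dist (π p) (π q) < A)
    {b : ℝ → X} (hb : IsRay b) {t₀ : ℝ} (ht₀ : 0 ≤ t₀)
    (hfar : ∀ t, t₀ ≤ t → 2 * A < dist (b t) (π (b t))) {t : ℝ} (ht : t₀ ≤ t) :
    dist (π (b t₀)) (π (b t)) ≤ 10 * A := by
  have near : ∀ u v, t₀ ≤ u → t₀ ≤ v → |u - v| ≤ dist (b u) (π (b u)) - 2 * A →
      dist (π (b u)) (π (b v)) ≤ A := fun u v hu hv huv => by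
    refine (hcon _ _ ?_).le
    rw [hb u v (ht₀.trans hu) (ht₀.trans hv)]
    linarith
  have steps : ∀ n : ℕ, ∀ u v, t₀ ≤ u → u ≤ v → v - u ≤ n * (2 * A) →
      dist (π (b u)) (π (b v)) ≤ n * A := by
    intro n
    induction n with
    | zero =>
      intro u v _ huv h
      have : u = v := by
        push_cast at h
        linarith
      simp [this]
    | succ n ih =>
      intro u v hu huv h
      push_cast at h ⊢
      rcases le_total v (u + 2 * A) with hv | hv
      · have : dist (π (b u)) (π (b v)) ≤ A := by
          refine (hcon _ _ ?_).le
          rw [hb u v (ht₀.trans hu) ((ht₀.trans hu).trans huv), abs_sub_comm,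
            abs_of_nonneg (by linarith)]
          linarith [hfar u hu]
        nlinarith [mul_nonneg (Nat.cast_nonneg (α := ℝ) n) hA.le]
      · have h1 : dist (π (b u)) (π (b (u + 2 * A))) ≤ A := by
          refine (hcon _ _ ?_).le
          rw [hb u _ (ht₀.trans hu) (by linarith), abs_sub_comm, abs_of_nonneg (by linarith)]
          linarith [hfar u hu]
        have h2 := ih (u + 2 * A) v (by linarith) hv (by linarith)
        linarith [dist_triangle (π (b u)) (π (b (u + 2 * A))) (π (b v))]
  have D₀ := hfar t₀ le_rfl
  have D₁ := hfar t ht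
  set d₀ := dist (b t₀) (π (b t₀))
  set d₁ := dist (b t) (π (b t))
  have tri : t - t₀ ≤ d₀ + dist (π (b t₀)) (π (b t)) + d₁ := by
    have := dist_triangle4 (b t₀) (π (b t₀)) (π (b t)) (b t)
    rw [hb _ _ ht₀ (ht₀.trans ht), abs_sub_comm, abs_of_nonneg (by linarith),
      dist_comm _ (b t)] at this
    exact this
  rcases le_total (t - (d₁ - 2 * A)) (t₀ + (d₀ - 2 * A)) with hL | hL
  · have hw : t₀ ≤ min t (t₀ + (d₀ - 2 * A)) := le_min ht (by linarith)
    have h1 := near t₀ (min t (t₀ + (d₀ - 2 * A))) le_rfl hw (by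
      rw [abs_sub_comm, abs_of_nonneg (by linarith)]
      linarith [min_le_right t (t₀ + (d₀ - 2 * A))])
    have h2 := near t (min t (t₀ + (d₀ - 2 * A))) ht hw (by
      rw [abs_of_nonneg (by linarith [min_le_left t (t₀ + (d₀ - 2 * A))])]
      have : t - (d₁ - 2 * A) ≤ min t (t₀ + (d₀ - 2 * A)) := le_min (by linarith) hL
      linarith)
    have := dist_triangle_right (π (b t₀)) (π (b t)) (π (b (min t (t₀ + (d₀ - 2 * A)))))
    linarith
  · set u := t₀ + (d₀ - 2 * A) with hu
    set v := t - (d₁ - 2 * A) with hv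
    have h1 := near t₀ u le_rfl (by linarith) (by
      rw [abs_sub_comm, abs_of_nonneg (by linarith)]
      linarith)
    have h2 := near t v ht (by linarith) (by
      rw [abs_of_nonneg (by linarith)]
      linarith)
    have hn1 := Nat.le_ceil ((v - u) / (2 * A))
    have hn2 := Nat.ceil_lt_add_one (show 0 ≤ (v - u) / (2 * A) from
      div_nonneg (by linarith) (by linarith))
    rw [div_le_iff₀ (by linarith)] at hn1
    have h3 := steps _ u v (by linarith) hL hn1
    have h4 : (⌈(v - u) / (2 * A)⌉₊ : ℝ) * A ≤ (v - u) / 2 + A := by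
      calc (⌈(v - u) / (2 * A)⌉₊ : ℝ) * A ≤ ((v - u) / (2 * A) + 1) * A := by gcongr
        _ = (v - u) / 2 + A := by field_simp
    have := dist_triangle4 (π (b t₀)) (π (b u)) (π (b v)) (π (b t))
    rw [dist_comm (π (b v))] at this
    linarith

/-- The projections of a ray to a line along which they stay bounded accumulate at a point from
which a ray asymptotic to the given one leaves perpendicularly to the line. -/
lemma IsCAT0.exists_perpendicular_ray [ProperSpace X] (hX : IsCAT0 X) {a b : ℝ → X}
    (hb : IsRay b) {s : ℕ → ℝ} {K : ℝ}
    (ha : IsGeodesicLine a) (hs : ∀ᶠ n in atTop, |s n| ≤ K)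
    (hmin : ∀ (n : ℕ) (r : ℝ), dist (b n) (a (s n)) ≤ dist (b n) (a r)) :
    ∃ (r : ℝ) (c : ℝ → X), IsRay c ∧ c 0 = a r ∧ Asymp c b ∧
      ∀ t, 0 ≤ t → ∀ r', t ≤ dist (c t) (a r') := by
  have hacont : Continuous a :=
    (Isometry.of_dist_eq fun x y => by rw [ha, Real.dist_eq]).continuous
  obtain ⟨U, hU⟩ : ∃ U : Ultrafilter ℕ, (U : Filter ℕ) ≤ atTop := ⟨_, Ultrafilter.of_le _⟩
  obtain ⟨r, -, hr⟩ := (isCompact_Icc (a := -K) (b := K)).ultrafilter_le_nhds (U.map s) (by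
    rw [le_principal_iff]
    exact hU (hs.mono fun n hn => abs_le.1 hn))
  replace hr : Tendsto s U (nhds r) := hr
  have har : Tendsto (fun n => a (s n)) U (nhds (a r)) := hacont.continuousAt.tendsto.comp hr
  have hlarge : ∀ t : ℝ, ∀ᶠ n : ℕ in U, t < n := fun t =>
    hU (tendsto_natCast_atTop_atTop.eventually_gt_atTop t)
  have hpt : ∀ (t : ℝ) (n : ℕ), ∃ m, 0 ≤ t → t < n → IsDivPt (a (s n)) (b n) m (t / n) := by
    intro t n
    by_cases h : 0 ≤ t ∧ t < n
    · obtain ⟨m, hm⟩ := hX.exists_isDivPt (a (s n)) (b n) (l := t / n)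
        (div_nonneg h.1 n.cast_nonneg) ((div_le_one (h.1.trans_lt h.2)).2 h.2.le)
      exact ⟨m, fun _ _ => hm⟩
    · exact ⟨b 0, fun h1 h2 => (h ⟨h1, h2⟩).elim⟩
  choose f hf using hpt
  obtain ⟨M, hM⟩ : ∃ M, ∀ᶠ n in U, dist (a (s n)) (b 0) ≤ M :=
    ⟨dist (a r) (b 0) + 1, (har.dist tendsto_const_nhds).eventually_le_const (by linarith)⟩
  have hfb : ∀ t, 0 ≤ t → ∀ᶠ n in U, dist (f t n) (b t) ≤ M := by
    intro t ht
    filter_upwards [hlarge t, hM] with n hn hnM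
    have hn0 : (0 : ℝ) < n := ht.trans_lt hn
    have l0 : 0 ≤ t / n := by positivity
    have l1 : t / n ≤ 1 := (div_le_one hn0).2 hn.le
    have hd := hb.isDivPt hX l0 l1 hn0.le
    rw [div_mul_cancel₀ t hn0.ne'] at hd
    have := (hf t n ht hn).dist_le hd l0 l1
    exact (this.trans (mul_le_of_le_one_left dist_nonneg (by linarith))).trans hnM
  have hlim : ∀ t, ∃ x, 0 ≤ t → Tendsto (f t) U (nhds x) := by
    intro t
    by_cases ht : 0 ≤ t
    · obtain ⟨x, -, hx⟩ := (isCompact_closedBall (b t) M).ultrafilter_le_nhds (U.map (f t)) (by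
        rw [le_principal_iff]
        exact hfb t ht)
      exact ⟨x, fun _ => hx⟩
    · exact ⟨b 0, fun h => (ht h).elim⟩
  choose c hc using hlim
  have hratio : Tendsto (fun n : ℕ => dist (a (s n)) (b n) / n) U (nhds 1) := by
    have hz : Tendsto (fun n : ℕ => M / (n : ℝ)) U (nhds 0) :=
      (tendsto_const_div_atTop_nhds_zero_nat M).mono_left hU
    rw [tendsto_iff_dist_tendsto_zero]
    refine tendsto_of_tendsto_of_tendsto_of_le_of_le' tendsto_const_nhds hz
      (Eventually.of_forall fun n => dist_nonneg) ?_
    filter_upwards [hlarge 0, hM] with n hn hnM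
    have h1 : |dist (a (s n)) (b n) - n| ≤ M := by
      have := abs_dist_sub_le (a (s n)) (b 0) (b n)
      rw [hb.dist_zero hn.le] at this
      exact this.trans hnM
    calc dist (dist (a (s n)) (b n) / n) 1 = |(dist (a (s n)) (b n) - n) / n| := by
          rw [Real.dist_eq, sub_div, div_self hn.ne']
      _ = |dist (a (s n)) (b n) - n| / n := by rw [abs_div, abs_of_pos hn]
      _ ≤ M / n := by gcongr
  have hdist : ∀ t t', 0 ≤ t → 0 ≤ t' → dist (c t) (c t') = |t - t'| := by
    intro t t' ht ht'
    refine tendsto_nhds_unique ((hc t ht).dist (hc t' ht')) ?_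
    have := hratio.const_mul |t - t'|
    rw [mul_one] at this
    refine this.congr' ?_
    filter_upwards [hlarge t, hlarge t'] with n hn hn'
    have hn0 : (0 : ℝ) < n := ht.trans_lt hn
    rw [(hf t n ht hn).dist_eq (hf t' n ht' hn') (by positivity) ((div_le_one hn0).2 hn.le)
      (by positivity) ((div_le_one hn0).2 hn'.le), ← sub_div, abs_div, abs_of_pos hn0]
    ring
  have hc0 : c 0 = a r := by
    refine tendsto_nhds_unique (hc 0 le_rfl) (har.congr' ?_)
    filter_upwards [hlarge 0] with n hn
    have := (hf 0 n le_rfl hn).dist_left_le (by simp)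
    rw [zero_div, zero_mul] at this
    exact dist_le_zero.1 this
  refine ⟨r, c, hdist, hc0, ⟨M, fun t ht => ?_⟩, fun t ht r' => ?_⟩
  · exact le_of_tendsto ((hc t ht).dist tendsto_const_nhds) (hfb t ht)
  · have h1 : dist (c 0) (c t) ≤ dist (c t) (a r') := by
      rw [hc0]
      refine le_of_tendsto_of_tendsto (har.dist (hc t ht))
        ((hc t ht).dist (tendsto_const_nhds (x := a r'))) ?_
      filter_upwards [hlarge t] with n hn
      have hn0 : (0 : ℝ) < n := ht.trans_lt hn
      have l0 : 0 ≤ t / n := by positivity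
      have l1 : t / n ≤ 1 := (div_le_one hn0).2 hn.le
      have e1 := (hf t n ht hn).dist_left l0 l1
      have e2 := (hf t n ht hn).dist_right l0 l1
      have e3 := hmin n r'
      have e4 := dist_triangle (b n) (f t n) (a r')
      rw [dist_comm (b n) (a (s n))] at e3
      linarith
    rwa [hdist 0 t le_rfl ht, zero_sub, abs_neg, abs_of_nonneg ht] at h1

lemma compAngle_comm (p x y : X) : compAngle p x y = compAngle p y x := by
  unfold compAngle
  rw [dist_comm x y]
  congr 1
  ring

lemma rayAngle_comm {c c' : ℝ → X} (h : c 0 = c' 0) : rayAngle c c' = rayAngle c' c := by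
  unfold rayAngle
  congr 1
  ext θ
  constructor
  · rintro ⟨s, t, hs, ht, rfl⟩
    exact ⟨t, s, ht, hs, by rw [compAngle_comm, h]⟩
  · rintro ⟨s, t, hs, ht, rfl⟩
    exact ⟨t, s, ht, hs, by rw [compAngle_comm, h]⟩

lemma bdryAngle_comm (α β : ℝ → X) : bdryAngle α β = bdryAngle β α := by
  unfold bdryAngle
  congr 1
  ext θ
  constructor
  · rintro ⟨c, c', hc, hc', h, h1, h2, rfl⟩
    exact ⟨c', c, hc', hc, h.symm, h2, h1, rayAngle_comm h⟩
  · rintro ⟨c, c', hc, hc', h, h1, h2, rfl⟩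
    exact ⟨c', c, hc', hc, h.symm, h2, h1, rayAngle_comm h⟩

lemma rayAngle_le_pi (c c' : ℝ → X) : rayAngle c c' ≤ Real.pi := by
  have h : rayAngle c c' ≤ compAngle (c 0) (c 1) (c' 1) := by
    refine csInf_le ⟨0, ?_⟩ ⟨1, 1, one_pos, one_pos, rfl⟩
    rintro _ ⟨s, t, -, -, rfl⟩
    exact Real.arccos_nonneg _
  exact h.trans (Real.arccos_le_pi _)

lemma rayAngle_le_bdryAngle {α β c c' : ℝ → X} (hc : IsRay c) (hc' : IsRay c') (h : c 0 = c' 0)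
    (h1 : Asymp c α) (h2 : Asymp c' β) : rayAngle c c' ≤ bdryAngle α β := by
  refine le_csSup ⟨Real.pi, ?_⟩ ⟨c, c', hc, hc', h, h1, h2, rfl⟩
  rintro _ ⟨d, d', -, -, -, -, -, rfl⟩
  exact rayAngle_le_pi d d'

lemma pi_div_two_le_rayAngle {c c' : ℝ → X} (hc : IsRay c) (hc' : IsRay c') (h : c 0 = c' 0)
    (hd : ∀ s t, 0 < s → 0 < t → s ^ 2 + t ^ 2 ≤ dist (c s) (c' t) ^ 2) :
    Real.pi / 2 ≤ rayAngle c c' := by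
  refine le_csInf ⟨_, 1, 1, one_pos, one_pos, rfl⟩ ?_
  rintro _ ⟨s, t, hs, ht, rfl⟩
  unfold compAngle
  rw [← not_lt, Real.arccos_lt_pi_div_two, not_lt, hc.dist_zero hs.le, h, hc'.dist_zero ht.le]
  exact div_nonpos_of_nonpos_of_nonneg (by linarith [hd s t hs ht]) (by positivity)

/-- The Pythagorean inequality for a point whose nearest point on a ray is the origin. -/
lemma IsRay.sq_add_sq_le [ProperSpace X] (hX : IsCAT0 X) {c : ℝ → X} (hc : IsRay c) {x : X}
    (hx : ∀ s, 0 ≤ s → dist x (c 0) ≤ dist x (c s)) {s : ℝ} (hs : 0 ≤ s) :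
    s ^ 2 + dist x (c 0) ^ 2 ≤ dist x (c s) ^ 2 := by
  have key : ∀ l ∈ Ioc (0 : ℝ) 1, (1 - l) * s ^ 2 + dist x (c 0) ^ 2 ≤ dist x (c s) ^ 2 := by
    rintro l ⟨l0, l1⟩
    have h1 := hc.isDivPt hX l0.le l1 hs x
    have h2 : dist x (c 0) ^ 2 ≤ dist x (c (l * s)) ^ 2 := by
      gcongr
      exact hx _ (by positivity)
    rw [hc.dist_zero hs] at h1
    refine le_of_mul_le_mul_left ?_ l0
    linarith
  have hl : Tendsto (fun l : ℝ => (1 - l) * s ^ 2 + dist x (c 0) ^ 2) (nhdsWithin 0 (Ioi 0))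
      (nhds ((1 - 0) * s ^ 2 + dist x (c 0) ^ 2)) :=
    (Continuous.tendsto (by fun_prop) 0).mono_left nhdsWithin_le_nhds
  rw [sub_zero, one_mul] at hl
  exact le_of_tendsto hl (by
    filter_upwards [Ioc_mem_nhdsGT (zero_lt_one (α := ℝ))] with l hl using key l hl)

/-- The endpoint of a contracting line makes an angle at least `π / 2` with every other boundary
point. -/
lemma IsCAT0.pi_div_two_le_bdryAngle [ProperSpace X] (hX : IsCAT0 X) {a : ℝ → X}
    (ha : IsGeodesicLine a) {A : ℝ} (hA : ContractingSet A (range a)) {α β : ℝ → X}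
    (hα : Asymp α a) (hβ : IsRay β) (hβa : ¬ Asymp β a) :
    Real.pi / 2 ≤ bdryAngle α β := by
  by_cases hrev : Asymp β (fun t => a (-t))
  · refine le_trans (pi_div_two_le_rayAngle ha.isRay ha.reverse.isRay (by simp) ?_)
      (rayAngle_le_bdryAngle ha.isRay ha.reverse.isRay (by simp) hα.symm hrev.symm)
    intro s t hs ht
    rw [ha, sq_abs]
    nlinarith
  obtain ⟨π, hπ, hcon⟩ := hA
  choose σ hσ using fun p => (hπ p).1
  set B := max A 1
  have hB0 : 0 < B := lt_of_lt_of_le one_pos (le_max_right _ _)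
  have hconB : ∀ p q : X, dist p q < dist p (π p) → dist (π p) (π q) < B :=
    fun p q h => (hcon p q h).trans_le (le_max_left _ _)
  have hfar : ∀ᶠ t in atTop, 2 * B < dist (β t) (π (β t)) := by
    by_contra hnot
    rw [not_eventually] at hnot
    have : ∃ᶠ t in atTop, (∃ s, 0 ≤ s ∧ dist (β t) (a s) ≤ 2 * B) ∨
        ∃ s, 0 ≤ s ∧ dist (β t) (a (-s)) ≤ 2 * B := by
      refine hnot.mono fun t ht => ?_
      rw [not_lt, ← hσ] at ht
      rcases le_total 0 (σ (β t)) with h | h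
      · exact Or.inl ⟨_, h, ht⟩
      · exact Or.inr ⟨-σ (β t), by linarith, by rwa [neg_neg]⟩
    rcases frequently_or_distrib.1 this with h | h
    · exact hβa (hX.asymp_of_frequently hβ ha.isRay h)
    · exact hrev (hX.asymp_of_frequently hβ ha.reverse.isRay h)
  obtain ⟨t₁, ht₁⟩ := eventually_atTop.1 hfar
  set t₀ := max t₁ 0
  have hbound : ∀ t, t₀ ≤ t → dist (π (β t₀)) (π (β t)) ≤ 10 * B := fun t ht =>
    hβ.dist_proj_le hB0 hconB (le_max_right _ _)
      (fun u hu => ht₁ u ((le_max_left _ _).trans hu)) ht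
  have hs : ∀ᶠ n : ℕ in atTop, |σ (β n)| ≤ |σ (β t₀)| + 10 * B := by
    filter_upwards [tendsto_natCast_atTop_atTop.eventually_ge_atTop t₀] with n hn
    have h := hbound n hn
    rw [← hσ, ← hσ, ha, abs_sub_comm] at h
    linarith [abs_sub_abs_le_abs_sub (σ (β n)) (σ (β t₀))]
  obtain ⟨r, c, hc, hc0, hcβ, hperp⟩ := hX.exists_perpendicular_ray hβ ha hs (fun n r => by
    rw [hσ]
    exact (hπ _).2 _ (mem_range_self r))
  have har := ha.isRay_shift r
  have h0 : (fun t => a (r + t)) 0 = c 0 := by simp [hc0]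
  have hasymp : Asymp (fun t => a (r + t)) α :=
    Asymp.trans ⟨|r|, fun t _ => by rw [ha, add_sub_cancel_right]⟩ hα.symm
  refine le_trans (pi_div_two_le_rayAngle har hc h0 fun s t hs ht => ?_)
    (rayAngle_le_bdryAngle har hc h0 hasymp hcβ)
  have hx : dist (c t) (a (r + 0)) = t := by
    rw [add_zero, ← hc0, dist_comm, hc.dist_zero ht.le]
  have := har.sq_add_sq_le hX (x := c t)
    (fun s _ => hx.le.trans (hperp t ht.le _)) hs.le
  simp only [hx] at this
  rwa [dist_comm]

/-- An angle-continuous path starting at the endpoint of a contracting line is constant. -/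
lemma IsCAT0.asymp_of_angleCont [ProperSpace X] (hX : IsCAT0 X) {a : ℝ → X}
    (ha : IsGeodesicLine a) {A : ℝ} (hA : ContractingSet A (range a)) {γ : ℝ → ℝ → X}
    (hγ : ∀ t ∈ Icc (0 : ℝ) 1, IsRay (γ t)) (hcont : AngleCont γ) (h0 : Asymp (γ 0) a) :
    Asymp (γ 1) a := by
  have hone : (1 : ℝ) < Real.pi / 2 := by linarith [Real.pi_gt_three]
  have hloc : IsLocallyConstant (fun t : Icc (0 : ℝ) 1 => Asymp (γ t) a) := by
    rw [IsLocallyConstant.iff_eventually_eq]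
    rintro ⟨t, ht⟩
    obtain ⟨δ, hδ, h⟩ := hcont t ht 1 one_pos
    filter_upwards [ball_mem_nhds _ hδ]
    rintro ⟨s, hs⟩ hst
    have hlt := h s hs hst
    refine propext ⟨fun hsa => ?_, fun hta => ?_⟩ <;> by_contra hnot
    · linarith [hX.pi_div_two_le_bdryAngle ha hA hsa (hγ t ht) hnot]
    · have := hX.pi_div_two_le_bdryAngle ha hA hta (hγ s hs) hnot
      rw [bdryAngle_comm] at this
      linarith
  have : PreconnectedSpace (Icc (0 : ℝ) 1) := Subtype.preconnectedSpace isPreconnected_Icc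
  have := hloc.apply_eq_of_preconnectedSpace (⟨0, by simp⟩ : Icc (0 : ℝ) 1) ⟨1, by simp⟩
  exact this.mp h0

theorem tits_distance_gt_pi [ProperSpace X] [CompleteSpace X] (hX : IsCAT0 X)
    (a : ℝ → X) (ha : IsGeodesicLine a)
    (hac : ∃ A : ℝ, ContractingSet A (range a))
    (Λ : Set (ℝ → X)) (hΛ : ∀ ξ ∈ Λ, IsRay ξ)
    (hvis : ∀ ξ ∈ Λ, ∃ g : ℝ → X, IsGeodesicLine g ∧
      Asymp (fun t => g t) ξ ∧ Asymp (fun t => g (-t)) (fun t => a t)) :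
    ∀ ξ ∈ Λ, ENNReal.ofReal Real.pi < titsDist (fun t => a t) ξ := by
  intro ξ hξ
  obtain ⟨A, hA⟩ := hac
  obtain ⟨g, hg, hgξ, hga⟩ := hvis ξ hξ
  have hξa : ¬ Asymp ξ a := fun h => hg.not_asymp_reverse ((hgξ.trans h).trans hga.symm)
  have htop : titsDist (fun t => a t) ξ = ⊤ := by
    rw [titsDist, sInf_eq_top]
    rintro _ ⟨γ, hγ, hcont, h0, h1, -⟩
    exact (hξa (h1.symm.trans (hX.asymp_of_angleCont ha hA hγ hcont h0))).elim
  rw [htop]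
  exact ENNReal.ofReal_lt_top
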